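/- arXiv:1607.01605 — 3 statements merged into one kernel-verified Lean document; each statement's English description precedes it below -/
import Mathlib

section
/- There exists a partition of the set E^9 of even-weight binary words of length 9 into 13 codes, each of which has minimum Hamming distance at least 4 (equivalently, Q_8^2 admits a proper 13-coloring). -/
abbrev Word (n : ℕ) := Fin n → ZMod 2

/-- The colors of a proper 13-coloring of `Q_8^2`, packed into base-16 digits: the color of the
word whose bits are those of `n < 256` is the digit at position `n`. -/
def colorTable : ℕ :=
  39752855914720655126913458691524991805577838243686378223394496907456733688776862613303281266800217892012239619447108519365593214637822013699483139223467861517985400871075515993585932567693198195658210043408151558750966679152374279484134921855982466067766026152858574111935399808895428687812803805748395465908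

/-- The color of a word of length 9, given as a number below 512. It ignores the lowest bit,
which in an even-weight word is determined by the others. -/
def natColor (n : ℕ) : ℕ := colorTable >>> (4 * (n / 2)) % 16

/-- The number whose binary digits are the entries of a binary word. -/
def wordToNat {n : ℕ} (x : Word n) : ℕ := Nat.ofBits fun i => decide (x i = 1)

/-- The binary word of length `n` whose entries are the low binary digits of `m`. -/
def natToWord (n m : ℕ) : Word n := fun i => if m.testBit i then 1 else 0

theorem natColor_lt : ∀ n < 512, natColor n < 13 := by
  decide +kernel

theorem natColor_ne : ∀ n < 512, ∀ j < 9, ∀ i < j,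
    natColor (n ^^^ (2 ^ i ^^^ 2 ^ j)) ≠ natColor n := by
  decide +kernel

theorem exists_even_natColor_eq : ∀ c < 13, ∃ m < 512,
    Even (hammingNorm (natToWord 9 m)) ∧ natColor (wordToNat (natToWord 9 m)) = c := by
  decide +kernel

theorem wordToNat_lt (x : Word 9) : wordToNat x < 512 :=
  Nat.ofBits_lt_two_pow _

theorem zmod_two_eq_zero_or_one (a : ZMod 2) : a = 0 ∨ a = 1 := by
  revert a; decide

theorem even_hammingNorm_iff {n : ℕ} (x : Word n) : Even (hammingNorm x) ↔ ∑ i, x i = 0 := by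
  rw [← ZMod.natCast_eq_zero_iff_even, hammingNorm, Finset.card_filter, Nat.cast_sum]
  have (i : Fin n) : ((if x i ≠ 0 then 1 else 0 : ℕ) : ZMod 2) = x i := by
    rcases zmod_two_eq_zero_or_one (x i) with h | h <;> simp [h]
  simp only [this]

theorem even_hammingDist {n : ℕ} {x y : Word n} (hx : Even (hammingNorm x))
    (hy : Even (hammingNorm y)) : Even (hammingDist x y) := by
  rw [even_hammingNorm_iff] at hx hy
  rw [hammingDist_eq_hammingNorm, even_hammingNorm_iff]
  simp [Finset.sum_add_distrib, hx, hy]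

/-- Changing two entries of a word flips the two corresponding binary digits. -/
theorem wordToNat_eq_xor {n : ℕ} {x y : Word n} {i j : Fin n} (hij : i ≠ j)
    (h : ∀ k, x k ≠ y k ↔ k = i ∨ k = j) :
    wordToNat y = wordToNat x ^^^ (2 ^ (i : ℕ) ^^^ 2 ^ (j : ℕ)) := by
  refine Nat.eq_of_testBit_eq fun k => ?_
  simp only [wordToNat, Nat.testBit_xor, Nat.testBit_two_pow]
  by_cases hk : k < n
  · have hxy := h ⟨k, hk⟩
    rw [Nat.testBit_ofBits_lt _ _ hk, Nat.testBit_ofBits_lt _ _ hk]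
    simp only [Fin.ext_iff] at hxy hij
    rcases zmod_two_eq_zero_or_one (x ⟨k, hk⟩) with hx | hx <;>
      rcases zmod_two_eq_zero_or_one (y ⟨k, hk⟩) with hy | hy <;>
      simp only [hx, hy] at hxy ⊢ <;> simp at hxy ⊢ <;> grind
  · rw [Nat.testBit_ofBits_ge _ _ (by omega), Nat.testBit_ofBits_ge _ _ (by omega)]
    have := i.isLt
    have := j.isLt
    simp
    omega

theorem natColor_wordToNat_ne {x y : Word 9} (h : hammingDist x y = 2) :
    natColor (wordToNat x) ≠ natColor (wordToNat y) := by
  obtain ⟨i, j, hij, hs⟩ := Finset.card_eq_two.mp h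
  have hd (k : Fin 9) : x k ≠ y k ↔ k = i ∨ k = j := by
    simpa using Finset.ext_iff.mp hs k
  wlog hlt : i < j generalizing i j
  · exact this j i hij.symm (by rw [hs, Finset.pair_comm]) (fun k => by rw [hd k, or_comm])
      (lt_of_le_of_ne (not_lt.mp hlt) hij.symm)
  rw [wordToNat_eq_xor hij hd]
  exact (natColor_ne _ (wordToNat_lt x) j j.isLt i hlt).symm

theorem four_le_hammingDist {x y : Word 9} (hx : Even (hammingNorm x))
    (hy : Even (hammingNorm y)) (hc : natColor (wordToNat x) = natColor (wordToNat y))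
    (hxy : x ≠ y) : 4 ≤ hammingDist x y := by
  have hpos := hammingDist_pos.mpr hxy
  have htwo : hammingDist x y ≠ 2 := fun h => natColor_wordToNat_ne h hc
  obtain ⟨k, hk⟩ := even_hammingDist hx hy
  omega

/-- The code of all even-weight words of length 9 of color `c`. -/
def colorCode (c : ℕ) : Finset (Word 9) :=
  {x | Even (hammingNorm x) ∧ natColor (wordToNat x) = c}

theorem mem_colorCode {c : ℕ} {x : Word 9} :
    x ∈ colorCode c ↔ Even (hammingNorm x) ∧ natColor (wordToNat x) = c := by
  simp [colorCode]

theorem colorCode_nonempty {c : ℕ} (hc : c < 13) : (colorCode c).Nonempty := by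
  obtain ⟨m, -, hm⟩ := exists_even_natColor_eq c hc
  exact ⟨_, mem_colorCode.mpr hm⟩

/-- There is a partition of the set `E⁹` of even-weight binary words of length 9
into 13 codes, each with minimum Hamming distance at least 4. -/
theorem exists_13_partition_E9 :
    ∃ 𝒞 : Finset (Finset (Word 9)),
      𝒞.card = 13 ∧
      (∀ C ∈ 𝒞, C.Nonempty) ∧
      (𝒞 : Set (Finset (Word 9))).PairwiseDisjoint id ∧
      (∀ x : Word 9, Even (hammingNorm x) ↔ ∃ C ∈ 𝒞, x ∈ C) ∧
      (∀ C ∈ 𝒞, ∀ x ∈ C, ∀ y ∈ C, x ≠ y → 4 ≤ hammingDist x y) := by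
  refine ⟨(Finset.range 13).image colorCode, ?_, ?_, ?_, fun x => ⟨fun hx => ?_, ?_⟩, ?_⟩
  · rw [Finset.card_image_of_injOn, Finset.card_range]
    intro a ha b _ hab
    obtain ⟨x, hx⟩ := colorCode_nonempty (Finset.mem_range.mp ha)
    have hx' : x ∈ colorCode b := by rwa [← show colorCode a = colorCode b from hab]
    exact (mem_colorCode.mp hx).2.symm.trans (mem_colorCode.mp hx').2
  · simp only [Finset.forall_mem_image, Finset.mem_range]
    exact fun _ => colorCode_nonempty
  · simp only [Finset.coe_image]
    rintro _ ⟨a, -, rfl⟩ _ ⟨b, -, rfl⟩ hab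
    refine Finset.disjoint_left.mpr fun x hxa hxb => hab ?_
    rw [← (mem_colorCode.mp hxa).2, (mem_colorCode.mp hxb).2]
  · exact ⟨_, Finset.mem_image_of_mem _ (Finset.mem_range.mpr (natColor_lt _ (wordToNat_lt x))),
      mem_colorCode.mpr ⟨hx, rfl⟩⟩
  · rintro ⟨C, hC, hx⟩
    obtain ⟨c, -, rfl⟩ := Finset.mem_image.mp hC
    exact (mem_colorCode.mp hx).1
  · simp only [Finset.forall_mem_image]
    intro c _ x hx y hy
    obtain ⟨hx, hxc⟩ := mem_colorCode.mp hx
    obtain ⟨hy, hyc⟩ := mem_colorCode.mp hy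
    exact four_le_hammingDist hx hy (hxc.trans hyc.symm)
end

section
/- Let 𝒞 be a partition of E^n that contains N ≥ 1 codes of size M. Let H be a subgroup of Aut(𝒞) such that |H| is a power of a prime p. If |H| and N are coprime, then H ≤ Aut(C) for some code C ∈ 𝒞 of size M. -/
/-- Membership in the group `Gₙ` of operations maintaining equivalence of even binary
codes: permutations of words of the form `x ↦ π·x + c` where `π` permutes the `n`
coordinates and `c` is an even-weight word. -/
def GnSet (n : ℕ) : Set (Equiv.Perm (Word n)) :=
  {g | ∃ (π : Equiv.Perm (Fin n)) (c : Word n), Even (hammingNorm c) ∧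
    ∀ (x : Word n) (i : Fin n), g x i = x (π⁻¹ i) + c i}

/-- `𝒞` is a partition of the set `Eⁿ` of even-weight words of length `n`. -/
def IsPartitionOfEn (n : ℕ) (𝒞 : Finset (Finset (Word n))) : Prop :=
  (∀ C ∈ 𝒞, C.Nonempty) ∧ (𝒞 : Set (Finset (Word n))).PairwiseDisjoint id ∧
    ∀ x : Word n, Even (hammingNorm x) ↔ ∃ C ∈ 𝒞, x ∈ C

/-- The action of `g` on a code. -/
def actCode {n : ℕ} (g : Equiv.Perm (Word n)) (C : Finset (Word n)) : Finset (Word n) :=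
  C.image ⇑g

/-- The action of `g` on a partition. -/
def actPart {n : ℕ} (g : Equiv.Perm (Word n)) (𝒞 : Finset (Finset (Word n))) :
    Finset (Finset (Word n)) :=
  𝒞.image (actCode g)

theorem actCode_card {n : ℕ} (g : Equiv.Perm (Word n)) (C : Finset (Word n)) :
    (actCode g C).card = C.card :=
  Finset.card_image_of_injective _ g.injective

theorem actCode_one {n : ℕ} (C : Finset (Word n)) : actCode 1 C = C :=
  Finset.image_id

theorem actCode_mul {n : ℕ} (g h : Equiv.Perm (Word n)) (C : Finset (Word n)) :
    actCode (g * h) C = actCode g (actCode h C) := by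
  simp only [actCode, Finset.image_image, Equiv.Perm.coe_mul]

theorem actCode_mem_of_actPart_eq {n : ℕ} {g : Equiv.Perm (Word n)}
    {𝒞 : Finset (Finset (Word n))} (hg : actPart g 𝒞 = 𝒞) {C : Finset (Word n)} (hC : C ∈ 𝒞) :
    actCode g C ∈ 𝒞 :=
  hg ▸ Finset.mem_image_of_mem (actCode g) hC

/-- A group of automorphisms of a family of codes acts on its members of a given size. -/
@[reducible]
def codesOfSizeMulAction {n : ℕ} (M : ℕ) {𝒞 : Finset (Finset (Word n))}
    {H : Subgroup (Equiv.Perm (Word n))} (hH : ∀ h ∈ H, actPart h 𝒞 = 𝒞) :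
    MulAction H (𝒞.filter fun C => C.card = M) where
  smul h C := ⟨actCode h C, Finset.mem_filter.2
    ⟨actCode_mem_of_actPart_eq (hH h h.2) (Finset.mem_filter.1 C.2).1,
      (actCode_card _ _).trans (Finset.mem_filter.1 C.2).2⟩⟩
  one_smul C := Subtype.ext (actCode_one C.1)
  mul_smul g h C := Subtype.ext (actCode_mul g.1 h.1 C.1)

/-- Lemma 1: if a partition `𝒞` of `Eⁿ` contains `N ≥ 1` codes of size `M` and
`H ≤ Aut 𝒞` has prime-power order coprime to `N`, then `H ≤ Aut C` for some code
`C ∈ 𝒞` of size `M`. -/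
theorem subgroup_fixes_code_of_coprime (n N M : ℕ) (hN : 1 ≤ N)
    (𝒞 : Finset (Finset (Word n))) (hpart : IsPartitionOfEn n 𝒞)
    (hcount : (𝒞.filter fun C => C.card = M).card = N)
    (H : Subgroup (Equiv.Perm (Word n)))
    (hHG : (H : Set (Equiv.Perm (Word n))) ⊆ GnSet n)
    (hHaut : ∀ h ∈ H, actPart h 𝒞 = 𝒞)
    (p m : ℕ) (hp : p.Prime) (hcard : Nat.card H = p ^ m)
    (hcop : Nat.Coprime (Nat.card H) N) :
    ∃ C ∈ 𝒞, C.card = M ∧ ∀ h ∈ H, actCode h C = C := by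
  rcases Nat.eq_zero_or_pos m with rfl | hm
  · obtain ⟨C, hC⟩ := Finset.card_pos.1 (hcount ▸ hN)
    obtain ⟨hC, hCM⟩ := Finset.mem_filter.1 hC
    have hbot : H = ⊥ := Subgroup.eq_bot_of_card_eq H (by simpa using hcard)
    refine ⟨C, hC, hCM, fun h hh => ?_⟩
    rw [hbot, Subgroup.mem_bot] at hh
    rw [hh, actCode_one]
  · have := Fact.mk hp
    let _ := codesOfSizeMulAction M hHaut
    have hpN : ¬ p ∣ Nat.card (𝒞.filter fun C => C.card = M) := by
      rw [Nat.card_eq_fintype_card, Fintype.card_coe, hcount]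
      intro hdvd
      exact hp.one_lt.ne' <| Nat.eq_one_of_dvd_coprimes hcop
        (hcard ▸ dvd_pow_self p hm.ne') hdvd
    obtain ⟨C, hC⟩ := (IsPGroup.of_card hcard).nonempty_fixed_point_of_prime_not_dvd_card _ hpN
    obtain ⟨hC𝒞, hCM⟩ := Finset.mem_filter.1 C.2
    exact ⟨C, hC𝒞, hCM, fun h hh => congrArg Subtype.val (hC ⟨h, hh⟩)⟩
end

section
/- Let 𝒞 be a partition of E^9 into 13 codes, each of minimum Hamming distance at least 4. If |Aut(𝒞)| ≥ 3, then there is a subgroup H ≤ Aut(𝒞) whose order is 4 or an odd prime, and a code C ∈ 𝒞 such that H ≤ Aut(C). -/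
/-- The automorphism group of a partition, as a subset of the permutations. -/
def autPart (n : ℕ) (𝒞 : Finset (Finset (Word n))) : Set (Equiv.Perm (Word n)) :=
  {g | g ∈ GnSet n ∧ actPart g 𝒞 = 𝒞}

open scoped Pointwise

theorem even_hammingNorm_iff_sum_eq_zero {n : ℕ} (c : Word n) :
    Even (hammingNorm c) ↔ ∑ i, c i = 0 := by
  have h : ∀ a : ZMod 2, (if a ≠ 0 then 1 else 0) = a := by decide
  rw [← ZMod.natCast_eq_zero_iff_even, hammingNorm, Finset.card_filter]
  push_cast
  simp only [h]

/-- The group `Gₙ` as a subgroup of the permutations of words. -/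
def gnSubgroup (n : ℕ) : Subgroup (Equiv.Perm (Word n)) where
  carrier := GnSet n
  one_mem' := ⟨1, 0, by simp, by simp⟩
  mul_mem' := by
    rintro g h ⟨π, c, hc, hg⟩ ⟨σ, d, hd, hh⟩
    refine ⟨π * σ, fun i => d (π⁻¹ i) + c i, ?_, fun x i => ?_⟩
    · rw [even_hammingNorm_iff_sum_eq_zero] at *
      rw [Finset.sum_add_distrib, Equiv.sum_comp π⁻¹ d, hc, hd, add_zero]
    · simp [hg, hh, add_assoc]
  inv_mem' := by
    rintro g ⟨π, c, hc, hg⟩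
    refine ⟨π⁻¹, fun i => c (π i), ?_, fun x i => ?_⟩
    · rw [even_hammingNorm_iff_sum_eq_zero] at *
      rw [Equiv.sum_comp π c, hc]
    · have h := hg (g⁻¹ x) (π i)
      rw [show g (g⁻¹ x) = x from g.apply_symm_apply x,
        show π⁻¹ (π i) = i from π.symm_apply_apply i] at h
      rw [inv_inv, h, add_assoc, CharTwo.add_self_eq_zero, add_zero]

/-- The automorphism group of a partition, as a subgroup of the permutations of words. -/
def autPartSubgroup (n : ℕ) (𝒞 : Finset (Finset (Word n))) :
    Subgroup (Equiv.Perm (Word n)) :=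
  gnSubgroup n ⊓ MulAction.stabilizer (Equiv.Perm (Word n)) 𝒞

theorem coe_autPartSubgroup (n : ℕ) (𝒞 : Finset (Finset (Word n))) :
    (autPartSubgroup n 𝒞 : Set (Equiv.Perm (Word n))) = autPart n 𝒞 :=
  rfl

/-- The linear part of a power of an element of `Gₙ` is the power of the linear part. -/
theorem exists_pow_apply_eq {n : ℕ} {g : Equiv.Perm (Word n)} {π : Equiv.Perm (Fin n)}
    {c : Word n} (hg : ∀ x i, g x i = x (π⁻¹ i) + c i) (k : ℕ) :
    ∃ d : Word n, ∀ x i, (g ^ k) x i = x ((π ^ k)⁻¹ i) + d i := by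
  induction k with
  | zero => exact ⟨0, by simp⟩
  | succ k ih =>
    obtain ⟨d, hd⟩ := ih
    refine ⟨fun i => c ((π ^ k)⁻¹ i) + d i, fun x i => ?_⟩
    rw [pow_succ, Equiv.Perm.mul_apply, hd, hg, pow_succ, mul_inv_rev,
      Equiv.Perm.mul_apply, add_assoc]

/-- An element of `Gₙ` whose order divides a prime `p > n`, `p ≠ 2`, is trivial. -/
theorem eq_one_of_mem_GnSet_of_pow_prime_eq_one {n p : ℕ} (hp : p.Prime) (hnp : n < p)
    (hp2 : p ≠ 2) {g : Equiv.Perm (Word n)} (hg : g ∈ GnSet n) (hgp : g ^ p = 1) : g = 1 := by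
  obtain ⟨π, c, -, hg⟩ := hg
  obtain ⟨d, hd⟩ := exists_pow_apply_eq hg p
  simp only [hgp, Equiv.Perm.one_apply] at hd
  have hd0 : d = 0 := by
    ext i
    simpa using (hd 0 i).symm
  have hπp : π ^ p = 1 := by
    rw [← inv_eq_one]
    ext1 i
    have h := hd (Pi.single i 1) i
    by_contra hne
    rw [Equiv.Perm.one_apply] at hne
    rw [Pi.single_eq_same, Pi.single_eq_of_ne hne, hd0] at h
    simp at h
  have hπ : π = 1 := by
    rcases (Nat.dvd_prime hp).1 (orderOf_dvd_of_pow_eq_one hπp) with h | h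
    · exact orderOf_eq_one_iff.1 h
    · have hdvd := orderOf_dvd_natCard π
      rw [h, Nat.card_perm, Nat.card_fin, hp.dvd_factorial] at hdvd
      omega
  have hg2 : g ^ 2 = 1 := by
    ext x i
    simp [sq, hg, hπ, add_assoc, CharTwo.add_self_eq_zero]
  have hcop : Nat.gcd p 2 = 1 := (Nat.coprime_primes hp Nat.prime_two).2 hp2
  simpa [hcop] using pow_gcd_eq_one.2 ⟨hgp, hg2⟩

/-- A `p`-group of automorphisms of a partition into a number of codes not divisible by `p`
fixes one of the codes. -/
theorem exists_actCode_eq_of_isPGroup {n p : ℕ} [Fact p.Prime]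
    {𝒞 : Finset (Finset (Word n))} {H : Subgroup (Equiv.Perm (Word n))}
    (hH : (H : Set (Equiv.Perm (Word n))) ⊆ autPart n 𝒞) (hpH : IsPGroup p H)
    (hp : ¬ p ∣ 𝒞.card) : ∃ C ∈ 𝒞, ∀ h ∈ H, actCode h C = C := by
  let S : SubMulAction H (Finset (Word n)) :=
    { carrier := 𝒞
      smul_mem' := fun h C hC => by
        have h2 : actPart h 𝒞 = 𝒞 := (hH h.2).2
        have hmem : actCode (h : Equiv.Perm (Word n)) C ∈ actPart (h : Equiv.Perm (Word n)) 𝒞 :=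
          Finset.mem_image_of_mem _ hC
        rw [h2] at hmem
        exact hmem }
  have hS : Nat.card S = 𝒞.card := Nat.card_eq_finsetCard 𝒞
  obtain ⟨C, hC⟩ := hpH.nonempty_fixed_point_of_prime_not_dvd_card S (hS ▸ hp)
  exact ⟨C, C.2, fun h hh => congrArg Subtype.val (hC ⟨h, hh⟩)⟩

/-- If a partition `𝒞` of `E⁹` into 13 codes of minimum distance at least 4 has
`|Aut 𝒞| ≥ 3`, then some subgroup `H ≤ Aut 𝒞` of order 4 or odd prime order satisfies
`H ≤ Aut C` for some code `C ∈ 𝒞`. -/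
theorem exists_subgroup_fixing_code
    (𝒞 : Finset (Finset (Word 9))) (hpart : IsPartitionOfEn 9 𝒞)
    (hcard : 𝒞.card = 13)
    (hdist : ∀ C ∈ 𝒞, ∀ x ∈ C, ∀ y ∈ C, x ≠ y → 4 ≤ hammingDist x y)
    (haut : 3 ≤ (autPart 9 𝒞).ncard) :
    ∃ H : Subgroup (Equiv.Perm (Word 9)),
      (H : Set (Equiv.Perm (Word 9))) ⊆ autPart 9 𝒞 ∧
      (Nat.card H = 4 ∨ ((Nat.card H).Prime ∧ Odd (Nat.card H))) ∧
      ∃ C ∈ 𝒞, ∀ h ∈ H, actCode h C = C := by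
  have hcardA : Nat.card (autPartSubgroup 9 𝒞) = (autPart 9 𝒞).ncard := by
    rw [← coe_autPartSubgroup]
    exact Nat.card_coe_set_eq _
  have key : ∀ p k : ℕ, p.Prime → p ≠ 13 → p ^ k ∣ Nat.card (autPartSubgroup 9 𝒞) →
      ∃ H : Subgroup (Equiv.Perm (Word 9)),
        (H : Set (Equiv.Perm (Word 9))) ⊆ autPart 9 𝒞 ∧ Nat.card H = p ^ k ∧
        ∃ C ∈ 𝒞, ∀ h ∈ H, actCode h C = C := by
    intro p k hp hp13 hdvd
    have : Fact p.Prime := ⟨hp⟩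
    obtain ⟨K, hK⟩ := Sylow.exists_subgroup_card_pow_prime p hdvd
    have hKcard : Nat.card (K.map (autPartSubgroup 9 𝒞).subtype) = p ^ k := by
      rw [Subgroup.card_map_of_injective (Subgroup.subtype_injective _), hK]
    have hKsub : (K.map (autPartSubgroup 9 𝒞).subtype : Set (Equiv.Perm (Word 9))) ⊆
        autPart 9 𝒞 := by
      rw [← coe_autPartSubgroup]
      exact Subgroup.map_subtype_le K
    refine ⟨_, hKsub, hKcard,
      exists_actCode_eq_of_isPGroup (p := p) hKsub (IsPGroup.of_card hKcard) ?_⟩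
    rwa [hcard, Nat.prime_dvd_prime_iff_eq hp (by norm_num)]
  rcases Nat.four_dvd_or_exists_odd_prime_and_dvd_of_two_lt haut with h4 | ⟨p, hp, hdvd, hodd⟩
  · obtain ⟨H, hH, hHcard, hC⟩ := key 2 2 Nat.prime_two (by norm_num) (by rwa [hcardA])
    exact ⟨H, hH, Or.inl hHcard, hC⟩
  · have hp13 : p ≠ 13 := by
      rintro rfl
      have : Fact (Nat.Prime 13) := ⟨hp⟩
      obtain ⟨g, hg⟩ := exists_prime_orderOf_dvd_card' 13 (hcardA ▸ hdvd)
      have hg1 : (g : Equiv.Perm (Word 9)) = 1 :=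
        eq_one_of_mem_GnSet_of_pow_prime_eq_one hp (by norm_num) (by norm_num) g.2.1
          (by rw [← Subgroup.coe_pow, ← hg, pow_orderOf_eq_one, Subgroup.coe_one])
      rw [← Subgroup.orderOf_coe, hg1, orderOf_one] at hg
      norm_num at hg
    obtain ⟨H, hH, hHcard, hC⟩ := key p 1 hp hp13 (by rwa [hcardA, pow_one])
    rw [pow_one] at hHcard
    exact ⟨H, hH, Or.inr (hHcard.symm ▸ ⟨hp, hodd⟩), hC⟩
end
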